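/- arXiv:2304.07860 — 3 statements merged into one kernel-verified Lean document; each statement's English description precedes it below -/
import Mathlib

section
/- Let φ : ℝ^n → [0,∞) be a bounded C^1 radially symmetric, radially nonincreasing kernel, and let (x, v) : [0,∞) → ℝ^n × ℝ^n be a C^1 solution of ẋ = v, v̇ = −φ(x) v − x. If ∫_0^∞ φ(x(t)) dt = ∞, then |x(t)|² + |v(t)|² → 0 as t → ∞. (This follows because for all sufficiently small ε > 0 the modified energy Ẽ = |v|² + |x|² + ε φ(x) x·v is comparable to |v|² + |x|² and satisfies dẼ/dt ≤ −c φ(x) Ẽ for some c > 0.) -/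
open Set MeasureTheory Filter

/-- Radial monotonicity: the derivative along a direction of increasing norm is nonpositive. -/
lemma aux_fderiv_nonpos {V : Type*} [NormedAddCommGroup V] [InnerProductSpace ℝ V]
    (φ : V → ℝ) (hφ : Differentiable ℝ φ)
    (hφrad : ∀ z w : V, ‖z‖ ≤ ‖w‖ → φ w ≤ φ z) (x v : V) (h : 0 ≤ inner ℝ x v) :
    fderiv ℝ φ x v ≤ 0 := by
  have h1 : HasDerivAt (fun s : ℝ => x + s • v) v 0 := by
    have := ((hasDerivAt_id (0 : ℝ)).smul_const v).const_add x
    simpa using this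
  have h2 : HasDerivAt (fun s : ℝ => φ (x + s • v)) (fderiv ℝ φ x v) 0 := by
    have h3 : HasFDerivAt φ (fderiv ℝ φ x) (x + (0 : ℝ) • v) := by
      simpa using (hφ x).hasFDerivAt
    exact h3.comp_hasDerivAt (0 : ℝ) h1
  have h3 := h2.hasDerivWithinAt (s := Ioi 0)
  rw [hasDerivWithinAt_iff_tendsto_slope' (by simp)] at h3
  refine le_of_tendsto h3 ?_
  filter_upwards [self_mem_nhdsWithin] with s hs
  have hs' : (0 : ℝ) < s := hs
  have h4 : φ (x + s • v) ≤ φ x := by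
    apply hφrad
    have : ‖x‖ ^ 2 ≤ ‖x + s • v‖ ^ 2 := by
      rw [norm_add_sq_real, inner_smul_right]
      have := mul_nonneg hs'.le h
      nlinarith [sq_nonneg ‖s • v‖]
    exact le_of_sq_le_sq this (norm_nonneg _)
  rw [slope_def_field]
  apply div_nonpos_of_nonpos_of_nonneg
  · simpa using h4
  · simpa using hs'.le

lemma aux_sign {V : Type*} [NormedAddCommGroup V] [InnerProductSpace ℝ V]
    (φ : V → ℝ) (hφ : Differentiable ℝ φ)
    (hφrad : ∀ z w : V, ‖z‖ ≤ ‖w‖ → φ w ≤ φ z) (x v : V) :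
    fderiv ℝ φ x v * inner ℝ x v ≤ 0 := by
  rcases le_total 0 (inner ℝ x v) with h | h
  · exact mul_nonpos_of_nonpos_of_nonneg (aux_fderiv_nonpos φ hφ hφrad x v h) h
  · have := aux_fderiv_nonpos φ hφ hφrad x (-v) (by rw [inner_neg_right]; linarith)
    rw [map_neg] at this
    exact mul_nonpos_of_nonneg_of_nonpos (by linarith) h

/-- The algebraic dissipation inequality. -/
lemma aux_alg (B p X V q d ε : ℝ) (hB : 0 ≤ B) (hp : 0 ≤ p) (hpB : p ≤ B)
    (hq : |q| ≤ X * V) (hd : d * q ≤ 0) (hε : 0 < ε) (hε1 : ε * (1 + B ^ 2) ≤ 1) :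
    -2 * p * V ^ 2 + ε * (d * q + p * (V ^ 2 - p * q - X ^ 2))
      ≤ - (ε / 2) * p * (X ^ 2 + V ^ 2) := by
  have h1 : -(p * q) ≤ X ^ 2 / 2 + B ^ 2 * V ^ 2 / 2 := by
    have h2 : -(p * q) ≤ p * |q| := by nlinarith [neg_abs_le q]
    have h3 : p * |q| ≤ B * |q| := mul_le_mul_of_nonneg_right hpB (abs_nonneg q)
    have h4 : B * |q| ≤ B * (X * V) := mul_le_mul_of_nonneg_left hq hB
    nlinarith [sq_nonneg (X - B * V)]
  have h5 : ε * (V ^ 2 - p * q - X ^ 2) ≤ ε * (V ^ 2 - X ^ 2 / 2 + B ^ 2 * V ^ 2 / 2) :=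
    mul_le_mul_of_nonneg_left (by linarith) hε.le
  have h6 : ε * (1 + B ^ 2) * V ^ 2 ≤ 1 * V ^ 2 :=
    mul_le_mul_of_nonneg_right hε1 (sq_nonneg V)
  have h8 : 0 ≤ ε * B ^ 2 * V ^ 2 := by positivity
  have h7 : -2 * V ^ 2 + ε * (V ^ 2 - p * q - X ^ 2) ≤ - (ε / 2) * (X ^ 2 + V ^ 2) := by
    nlinarith
  have h9 := mul_le_mul_of_nonneg_left h7 hp
  have h10 : ε * (d * q) ≤ 0 := mul_nonpos_of_nonneg_of_nonpos hε.le hd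
  nlinarith

/-- For the relative dynamics `ẋ = v`, `v̇ = −φ(x)v − x` of a
two-agent Cucker–Smale system with quadratic confinement, if
`∫_0^∞ φ(x(t)) dt = ∞` then `|x(t)|² + |v(t)|² → 0` as `t → ∞`. -/
theorem stmt14 (n : ℕ) (φ : EuclideanSpace ℝ (Fin n) → ℝ)
    (hφC1 : ContDiff ℝ 1 φ) (hφnonneg : ∀ z, 0 ≤ φ z)
    (hφbdd : ∃ B : ℝ, ∀ z, φ z ≤ B)
    (hφrad : ∀ z w : EuclideanSpace ℝ (Fin n), ‖z‖ ≤ ‖w‖ → φ w ≤ φ z)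
    (x v : ℝ → EuclideanSpace ℝ (Fin n))
    (hx : ∀ t ∈ Set.Ici (0 : ℝ), HasDerivWithinAt x (v t) (Set.Ici 0) t)
    (hv : ∀ t ∈ Set.Ici (0 : ℝ),
      HasDerivWithinAt v (-(φ (x t)) • v t - x t) (Set.Ici 0) t)
    (hdiv : ∫⁻ t in Set.Ioi (0 : ℝ), ENNReal.ofReal (φ (x t)) = ⊤) :
    Tendsto (fun t => ‖x t‖ ^ 2 + ‖v t‖ ^ 2) atTop (nhds 0) := by
  obtain ⟨B, hB⟩ := hφbdd
  have hB0 : 0 ≤ B := (hφnonneg 0).trans (hB 0)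
  have hφd : Differentiable ℝ φ := hφC1.differentiable (by norm_num)
  have hxc : ContinuousOn x (Ici 0) := fun t ht => (hx t ht).continuousWithinAt
  have hvc : ContinuousOn v (Ici 0) := fun t ht => (hv t ht).continuousWithinAt
  have hxd : ∀ t, 0 < t → HasDerivAt x (v t) t := fun t ht =>
    (hx t ht.le).hasDerivAt (Ici_mem_nhds ht)
  have hvd : ∀ t, 0 < t → HasDerivAt v (-(φ (x t)) • v t - x t) t := fun t ht =>
    (hv t ht.le).hasDerivAt (Ici_mem_nhds ht)
  -- energy
  set E : ℝ → ℝ := fun t => ‖x t‖ ^ 2 + ‖v t‖ ^ 2 with hE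
  have hEc : ContinuousOn E (Ici 0) := (hxc.norm.pow 2).add (hvc.norm.pow 2)
  have hEd : ∀ t, 0 < t → HasDerivAt E (-2 * φ (x t) * ‖v t‖ ^ 2) t := by
    intro t ht
    have := (hxd t ht).norm_sq.add (hvd t ht).norm_sq
    refine HasDerivAt.congr_deriv this ?_
    rw [inner_sub_right, inner_smul_right, real_inner_self_eq_norm_sq,
      real_inner_comm (x t) (v t)]
    ring
  have hEanti : AntitoneOn E (Ici 0) := by
    apply antitoneOn_of_deriv_nonpos (convex_Ici 0) hEc
    · intro t ht
      rw [interior_Ici] at ht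
      exact (hEd t ht).differentiableAt.differentiableWithinAt
    · intro t ht
      rw [interior_Ici] at ht
      rw [(hEd t ht).deriv]
      have := mul_nonneg (hφnonneg (x t)) (sq_nonneg ‖v t‖)
      linarith
  have hE0 : ∀ t, 0 ≤ E t := fun t => by positivity
  -- main claim: the energy becomes small
  have key : ∀ L > 0, ∃ T, 0 ≤ T ∧ E T < L := by
    intro L hL
    by_contra! hcon
    obtain ⟨ε, hε, hε1⟩ : ∃ ε : ℝ, 0 < ε ∧ ε * (1 + B ^ 2) ≤ 1 :=
      ⟨1 / (1 + B ^ 2), by positivity, by field_simp; exact le_rfl⟩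
    set g : ℝ → ℝ := fun t => φ (x (max t 0)) with hg
    have hgc : Continuous g := by
      apply hφC1.continuous.comp
      exact hxc.comp_continuous (by fun_prop) (fun t => mem_Ici.mpr (le_max_right _ _))
    have hgt : ∀ t, 0 ≤ t → g t = φ (x t) := fun t ht => by simp [hg, max_eq_left ht]
    set F : ℝ → ℝ := fun t => E t + ε * (φ (x t) * inner ℝ (x t) (v t)) with hF
    set G : ℝ → ℝ := fun t => F t + ε / 2 * L * ∫ s in (0 : ℝ)..t, g s with hG
    have hId : ∀ t, HasDerivAt (fun t => ∫ s in (0 : ℝ)..t, g s) (g t) t := fun t =>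
      (hgc.integral_hasStrictDerivAt 0 t).hasDerivAt
    have hFc : ContinuousOn F (Ici 0) := by
      apply hEc.add
      apply continuousOn_const.mul
      exact (hφC1.continuous.comp_continuousOn hxc).mul (hxc.inner hvc)
    have hGc : ContinuousOn G (Ici 0) := by
      apply hFc.add
      apply continuousOn_const.mul
      exact fun t _ => (hId t).continuousAt.continuousWithinAt
    have hFd : ∀ t, 0 < t → HasDerivAt F (-2 * φ (x t) * ‖v t‖ ^ 2 +
        ε * (fderiv ℝ φ (x t) (v t) * inner ℝ (x t) (v t) +
          φ (x t) * (‖v t‖ ^ 2 - φ (x t) * inner ℝ (x t) (v t) - ‖x t‖ ^ 2))) t := by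
      intro t ht
      have h1 : HasDerivAt (fun t => φ (x t)) (fderiv ℝ φ (x t) (v t)) t :=
        (hφd (x t)).hasFDerivAt.comp_hasDerivAt t (hxd t ht)
      have h2 := (hxd t ht).inner ℝ (hvd t ht)
      have := (hEd t ht).add ((h1.mul h2).const_mul ε)
      refine HasDerivAt.congr_deriv this ?_
      rw [inner_sub_right, inner_smul_right, real_inner_self_eq_norm_sq,
        real_inner_self_eq_norm_sq]
      ring
    have hGd : ∀ t, 0 < t → HasDerivAt G (_ + ε / 2 * L * g t) t := fun t ht =>
      (hFd t ht).add ((hId t).const_mul (ε / 2 * L))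
    have hGanti : AntitoneOn G (Ici 0) := by
      apply antitoneOn_of_deriv_nonpos (convex_Ici 0) hGc
      · intro t ht
        rw [interior_Ici] at ht
        exact (hGd t ht).differentiableAt.differentiableWithinAt
      · intro t ht
        rw [interior_Ici] at ht
        have ht' : 0 < t := ht
        rw [(hGd t ht).deriv, hgt t ht'.le]
        have h1 := aux_alg B (φ (x t)) ‖x t‖ ‖v t‖ (inner ℝ (x t) (v t))
          (fderiv ℝ φ (x t) (v t)) ε hB0 (hφnonneg _) (hB _) (abs_real_inner_le_norm _ _)
          (aux_sign φ hφd hφrad _ _) hε hε1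
        have h2 : L ≤ ‖x t‖ ^ 2 + ‖v t‖ ^ 2 := hcon t ht'.le
        have h3 : 0 ≤ ε / 2 * φ (x t) := mul_nonneg (by positivity) (hφnonneg _)
        have h4 := mul_le_mul_of_nonneg_left h2 h3
        linarith
    have hF0 : ∀ t, 0 ≤ F t := by
      intro t
      have h1 := abs_real_inner_le_norm (x t) (v t)
      have h2 : ε * φ (x t) ≤ 1 := by
        have : ε * φ (x t) ≤ ε * B := mul_le_mul_of_nonneg_left (hB _) hε.le
        nlinarith [sq_nonneg (B - 1), mul_nonneg hε.le (sq_nonneg (B - 1)),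
          mul_nonneg hε.le hB0]
      have h3 : 0 ≤ ε * φ (x t) := mul_nonneg hε.le (hφnonneg _)
      have h4 : |ε * φ (x t) * inner ℝ (x t) (v t)| ≤ ‖x t‖ * ‖v t‖ := by
        rw [abs_mul, abs_of_nonneg h3]
        nlinarith [abs_nonneg (inner ℝ (x t) (v t))]
      have h5 := neg_abs_le (ε * φ (x t) * inner ℝ (x t) (v t))
      simp only [hF, hE]
      nlinarith [sq_nonneg (‖x t‖ - ‖v t‖), sq_nonneg ‖x t‖, sq_nonneg ‖v t‖]
    have hbound : ∀ t, 0 ≤ t → ∫ s in (0 : ℝ)..t, g s ≤ F 0 / (ε / 2 * L) := by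
      intro t ht
      have h1 := hGanti (mem_Ici.mpr le_rfl) (show t ∈ Ici 0 from ht) ht
      simp only [hG, intervalIntegral.integral_same, mul_zero, add_zero] at h1
      rw [le_div_iff₀ (by positivity)]
      have := hF0 t
      linarith
    have hint : IntegrableOn g (Ioi 0) := by
      refine integrableOn_Ioi_of_intervalIntegral_norm_bounded (F 0 / (ε / 2 * L)) 0
        (l := atTop) (b := id) (fun t => ?_) tendsto_id ?_
      · exact (hgc.integrableOn_Icc).mono_set Ioc_subset_Icc_self
      · filter_upwards [eventually_ge_atTop 0] with t ht
        refine le_trans (le_of_eq ?_) (hbound t ht)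
        congr 1
        ext s
        exact Real.norm_of_nonneg (hφnonneg _)
    have hlt := hint.lintegral_lt_top
    have heq : ∫⁻ t in Ioi (0 : ℝ), ENNReal.ofReal (g t)
        = ∫⁻ t in Ioi (0 : ℝ), ENNReal.ofReal (φ (x t)) := by
      apply setLIntegral_congr_fun measurableSet_Ioi
      intro t ht
      simp only [hgt t (le_of_lt ht)]
    rw [heq, hdiv] at hlt
    exact lt_irrefl _ hlt
  rw [Metric.tendsto_atTop]
  intro L hL
  obtain ⟨T, hT, hET⟩ := key L hL
  refine ⟨T, fun t ht => ?_⟩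
  rw [Real.dist_eq, sub_zero, abs_of_nonneg (hE0 t)]
  exact (hEanti hT (show t ∈ Ici 0 from hT.trans ht) ht).trans_lt hET
end

section
/- Let N = 2, let φ : ℝ^n → [0,∞) be a smooth radially symmetric, radially nonincreasing kernel with support equal to the closed ball of radius r₀ > 0, and let U(x) = |x|²/2 be the quadratic confining potential. Let ℋ ⊆ ℝ^{2n} × ℝ^{2n} denote the set of initial data whose solutions satisfy |x₁(t) − x₂(t)| ≥ r₀ for all t ≥ 0. Then for almost every initial datum (x₀, v₀) ∈ (ℝ^{2n} × ℝ^{2n}) \ ℋ (with respect to Lebesgue measure), the solution aligns and aggregates: |x₁(t) − x₂(t)| + |v₁(t) − v₂(t)| → 0 as t → ∞. -/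
open Set MeasureTheory Filter

lemma cs_anti {f f' : ℝ → ℝ} {a : ℝ} (ha : 0 ≤ a)
    (hf : ∀ t, a ≤ t → HasDerivWithinAt f (f' t) (Set.Ici 0) t)
    (hf' : ∀ t, a ≤ t → f' t ≤ 0) {s t : ℝ} (hs : a ≤ s) (hst : s ≤ t) : f t ≤ f s := by
  have h : AntitoneOn f (Set.Ici a) := by
    refine antitoneOn_of_hasDerivWithinAt_nonpos (f' := f') (convex_Ici a) ?_ ?_ ?_
    · intro x hx
      exact ((hf x hx).continuousWithinAt).mono (Set.Ici_subset_Ici.2 ha)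
    · intro x hx
      rw [interior_Ici] at hx ⊢
      exact (hf x (le_of_lt hx)).mono (fun y hy => ha.trans (le_of_lt hy))
    · intro x hx
      rw [interior_Ici] at hx
      exact hf' x (le_of_lt hx)
  exact h hs (hs.trans hst) hst

lemma cs_barb {E f f' : ℝ → ℝ} {K L : ℝ} (hK : 0 ≤ K)
    (hE : ∀ t, 0 ≤ t → HasDerivWithinAt E (-f t) (Set.Ici 0) t)
    (hf : ∀ t, 0 ≤ t → HasDerivWithinAt f (f' t) (Set.Ici 0) t)
    (hf' : ∀ t, 0 ≤ t → -K ≤ f' t) (hf0 : ∀ t, 0 ≤ t → 0 ≤ f t)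
    (hL : Tendsto E atTop (nhds L)) : Tendsto f atTop (nhds 0) := by
  have key : ∀ t δ, 0 ≤ t → 0 ≤ δ → f t * δ - K * δ ^ 2 / 2 ≤ E t - E (t + δ) := by
    intro t δ ht hδ
    have h1 : ∀ s, t ≤ s → f t - K * (s - t) ≤ f s := by
      intro s hs
      have := cs_anti (f := fun s => -f s - K * s) (f' := fun s => -f' s - K * 1) le_rfl
        (fun s hs => ((hf s hs).neg.sub ((hasDerivWithinAt_id s _).const_mul K)))
        (fun s hs => by have := hf' s hs; linarith) ht hs
      linarith
    have h2 := cs_anti (f := fun s => E s + f t * (s - t) - K / 2 * (s - t) ^ 2)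
      (f' := fun s => -f s + f t * 1 - K / 2 * ((2 : ℕ) * (s - t) ^ (2 - 1) * 1)) ht
        (fun s hs => by
          have h := ((hasDerivWithinAt_id s (Set.Ici 0)).sub_const t)
          exact ((hE s (ht.trans hs)).add (h.const_mul (f t))).sub ((h.pow 2).const_mul (K/2)))
        (fun s hs => by have := h1 s hs; norm_num; linarith) le_rfl
        (show t ≤ t + δ by linarith)
    ring_nf at h2 ⊢
    linarith
  rw [Metric.tendsto_atTop]
  intro ε hε
  rw [Metric.tendsto_atTop] at hL
  set δ := ε / (K + 1) with hδd
  have hδ : 0 < δ := by positivity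
  have hKδ : K * δ ≤ ε := by
    rw [hδd, ← mul_div_assoc, div_le_iff₀ (by positivity)]; nlinarith
  obtain ⟨T, hT⟩ := hL (ε * δ / 4) (by positivity)
  refine ⟨max T 0, fun t ht => ?_⟩
  have ht0 : 0 ≤ t := (le_max_right _ _).trans ht
  have htT : T ≤ t := (le_max_left _ _).trans ht
  have a1 := hT t htT
  have a2 := hT (t + δ) (by linarith)
  rw [Real.dist_eq, abs_lt] at a1 a2
  have := key t δ ht0 hδ.le
  rw [Real.dist_eq, sub_zero, abs_of_nonneg (hf0 t ht0)]
  have h3 : f t * δ < ε * δ := by nlinarith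
  exact lt_of_mul_lt_mul_right h3 hδ.le

lemma cs_core {p q D g g' : ℝ → ℝ} {G K ρ₀ t₀ : ℝ}
    (hp : ∀ t, 0 ≤ t → HasDerivWithinAt p (2 * D t) (Set.Ici 0) t)
    (hq : ∀ t, 0 ≤ t → HasDerivWithinAt q (-2 * g t * q t - 2 * D t) (Set.Ici 0) t)
    (hD : ∀ t, 0 ≤ t → HasDerivWithinAt D (q t - g t * D t - p t) (Set.Ici 0) t)
    (hg : ∀ t, 0 ≤ t → HasDerivWithinAt g (g' t) (Set.Ici 0) t)
    (hp0 : ∀ t, 0 ≤ p t) (hq0 : ∀ t, 0 ≤ q t) (hDpq : ∀ t, D t ^ 2 ≤ p t * q t)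
    (hg0 : ∀ t, 0 ≤ g t) (hgG : ∀ t, g t ≤ G) (hg' : ∀ t, 0 ≤ t → |g' t| ≤ K)
    (hc : ∀ ρ, ρ < ρ₀ → ∃ c, 0 < c ∧ ∀ t, p t ≤ ρ → c ≤ g t)
    (ht₀ : 0 ≤ t₀) (hpt : p t₀ < ρ₀) : Tendsto (fun t => p t + q t) atTop (nhds 0) := by
  have hG : 0 ≤ G := (hg0 0).trans (hgG 0)
  have hK : 0 ≤ K := (abs_nonneg _).trans (hg' 0 le_rfl)
  set f : ℝ → ℝ := fun t => g t * q t with hfd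
  set E : ℝ → ℝ := fun t => (p t + q t) / 2 with hEd
  set C : ℝ → ℝ := fun t => (p t - q t) / 2 with hCd
  have hf0 : ∀ t, 0 ≤ f t := fun t => mul_nonneg (hg0 t) (hq0 t)
  have hE : ∀ t, 0 ≤ t → HasDerivWithinAt E (-f t) (Set.Ici 0) t := fun t ht => by
    refine (((hp t ht).add (hq t ht)).div_const 2).congr_deriv ?_
    simp only [hfd]; ring
  have hC : ∀ t, 0 ≤ t → HasDerivWithinAt C (2 * D t + f t) (Set.Ici 0) t := fun t ht => by
    refine (((hp t ht).sub (hq t ht)).div_const 2).congr_deriv ?_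
    simp only [hfd]; ring
  have hE0 : ∀ t, 0 ≤ E t := fun t => by have := hp0 t; have := hq0 t; simp only [hEd]; linarith
  have hEanti : ∀ s t, 0 ≤ s → s ≤ t → E t ≤ E s := fun s t hs hst =>
    cs_anti le_rfl hE (fun t _ => by have := hf0 t; linarith) hs hst
  -- convergence of E
  obtain ⟨L, hL⟩ : ∃ L, Tendsto E atTop (nhds L) := by
    have hanti : Antitone (fun t => E (max t 0)) := fun s t hst =>
      hEanti _ _ (le_max_right _ _) (max_le_max_right 0 hst)
    have := tendsto_atTop_ciInf hanti ⟨0, by rintro _ ⟨t, rfl⟩; exact hE0 _⟩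
    refine ⟨_, this.congr' ?_⟩
    filter_upwards [eventually_ge_atTop (0 : ℝ)] with t ht
    rw [max_eq_left ht]
  have hLle : ∀ t, 0 ≤ t → L ≤ E t := fun t ht =>
    le_of_tendsto hL (by filter_upwards [eventually_ge_atTop t] with s hs using hEanti t s ht hs)
  have hL0 : 0 ≤ L := ge_of_tendsto' hL hE0
  rcases hL0.eq_or_lt with h0 | hLpos
  · have := hL.const_mul 2
    rw [← h0, mul_zero] at this
    refine this.congr fun t => ?_
    simp only [hEd]; ring
  exfalso
  have hEb : ∀ t, 0 ≤ t → E t ≤ E 0 := fun t ht => hEanti 0 t le_rfl ht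
  have hpb : ∀ t, 0 ≤ t → p t ≤ 2 * E 0 := fun t ht => by
    have := hEb t ht; have := hq0 t; simp only [hEd] at *; linarith
  have hqb : ∀ t, 0 ≤ t → q t ≤ 2 * E 0 := fun t ht => by
    have := hEb t ht; have := hp0 t; simp only [hEd] at *; linarith
  have hDE : ∀ t, |D t| ≤ E t := fun t => by
    apply abs_le_of_sq_le_sq _ (hE0 t)
    have := hDpq t
    simp only [hEd]; nlinarith [sq_nonneg (p t - q t)]
  -- f tends to 0
  have hf : Tendsto f atTop (nhds 0) := by
    refine cs_barb (K := K * (2 * E 0) + G * (2 * G * (2 * E 0) + 2 * E 0)) ?_ hE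
      (fun t ht => (hg t ht).mul (hq t ht)) ?_ (fun t _ => hf0 t) hL
    · have := hE0 0; positivity
    · intro t ht
      have h1 : |g' t * q t| ≤ K * (2 * E 0) := by
        rw [abs_mul, abs_of_nonneg (hq0 t)]
        exact mul_le_mul (hg' t ht) (hqb t ht) (hq0 t) hK
      have h2 : |g t * (-2 * g t * q t - 2 * D t)| ≤ G * (2 * G * (2 * E 0) + 2 * E 0) := by
        rw [abs_mul, abs_of_nonneg (hg0 t)]
        refine mul_le_mul (hgG t) ?_ (abs_nonneg _) hG
        have h3 : g t * q t ≤ G * (2 * E 0) := mul_le_mul (hgG t) (hqb t ht) (hq0 t) hG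
        have h4 := hf0 t
        have h5 := abs_le.1 ((hDE t).trans (hEb t ht))
        simp only [hfd] at h4
        rw [abs_le]; constructor <;> nlinarith
      have := (abs_le.1 h1).1
      have := (abs_le.1 h2).1
      linarith
  -- g D tends to 0
  have hgD : ∀ t, 0 ≤ t → |g t * D t| ≤ √(G * (2 * E 0) * f t) := fun t ht => by
    apply Real.abs_le_sqrt
    have h1 : g t * p t ≤ G * (2 * E 0) := mul_le_mul (hgG t) (hpb t ht) (hp0 t) hG
    calc (g t * D t) ^ 2 = g t ^ 2 * D t ^ 2 := by ring
      _ ≤ g t ^ 2 * (p t * q t) := mul_le_mul_of_nonneg_left (hDpq t) (sq_nonneg _)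
      _ = (g t * p t) * f t := by simp only [hfd]; ring
      _ ≤ _ := mul_le_mul_of_nonneg_right h1 (hf0 t)
  have herr : Tendsto (fun t => f t + √(G * (2 * E 0) * f t)) atTop (nhds 0) := by
    have := hf.add ((hf.const_mul (G * (2 * E 0))).sqrt)
    simpa using this
  -- monotonicity of smallest eigenvalue
  have hCE : ∀ t, C t ≤ E t := fun t => by have := hq0 t; simp only [hEd, hCd]; linarith
  have hRE : ∀ t, C t ^ 2 + D t ^ 2 ≤ E t ^ 2 := fun t => by
    have := hDpq t; simp only [hEd, hCd]; nlinarith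
  have hBε : ∀ ε : ℝ, 0 < ε → ∀ t, t₀ ≤ t →
      E t - √(C t ^ 2 + D t ^ 2 + ε) ≤ p t₀ := by
    intro ε hε t ht
    have h1 := cs_anti (f := fun t => E t - √(C t ^ 2 + D t ^ 2 + ε))
      (f' := fun t => -f t - (((2 : ℕ) * C t ^ (2 - 1) * (2 * D t + f t) +
          (2 : ℕ) * D t ^ (2 - 1) * (q t - g t * D t - p t))) /
            (2 * √(C t ^ 2 + D t ^ 2 + ε))) le_rfl
      (fun t ht => (hE t ht).sub (((((hC t ht).pow 2).add ((hD t ht).pow 2)).add_const ε).sqrt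
        (by simp only [Pi.add_apply, Pi.pow_apply]; positivity))) (fun t ht => by
        set S := √(C t ^ 2 + D t ^ 2 + ε) with hS
        have hSpos : 0 < S := Real.sqrt_pos.2 (by positivity)
        have hSsq : S ^ 2 = C t ^ 2 + D t ^ 2 + ε := Real.sq_sqrt (by positivity)
        set R := √(C t ^ 2 + D t ^ 2) with hR
        have hRsq : R ^ 2 = C t ^ 2 + D t ^ 2 := Real.sq_sqrt (by positivity)
        have hR0 : 0 ≤ R := Real.sqrt_nonneg _
        have hRS : R ≤ S := Real.sqrt_le_sqrt (by linarith)
        have hREt : R ≤ E t := Real.sqrt_le_iff.2 ⟨hE0 t, hRE t⟩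
        have hCR : |C t| ≤ R := Real.abs_le_sqrt (by nlinarith)
        have hCR' := abs_le.1 hCR
        have hqE : q t = E t - C t := by simp only [hEd, hCd]; ring
        have hpE : p t = E t + C t := by simp only [hEd, hCd]; ring
        have hmain : D t ^ 2 ≤ (E t - C t) * (S + C t) := by
          have : (R - C t) * (R + C t) ≤ (E t - C t) * (S + C t) :=
            mul_le_mul (by linarith) (by linarith) (by linarith) (by linarith)
          nlinarith
        have : -f t * (2 * S) ≤ ((2 : ℕ) * C t ^ (2 - 1) * (2 * D t + f t) +
          (2 : ℕ) * D t ^ (2 - 1) * (q t - g t * D t - p t)) := by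
          norm_num
          simp only [hfd]
          rw [hqE, hpE]
          nlinarith [mul_le_mul_of_nonneg_left hmain (hg0 t)]
        have := (le_div_iff₀ (by positivity : 0 < 2 * S)).2 this
        linarith) ht₀ ht
    refine h1.trans ?_
    have : |C t₀| ≤ √(C t₀ ^ 2 + D t₀ ^ 2 + ε) := Real.abs_le_sqrt (by nlinarith [sq_nonneg (D t₀)])
    have := (abs_le.1 this).1
    have hpE : p t₀ = E t₀ + C t₀ := by simp only [hEd, hCd]; ring
    linarith
  have hB : ∀ t, t₀ ≤ t → E t - √(C t ^ 2 + D t ^ 2) ≤ p t₀ := by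
    intro t ht
    have hcont : Tendsto (fun ε : ℝ => E t - √(C t ^ 2 + D t ^ 2 + ε)) (nhdsWithin 0 (Set.Ioi 0))
        (nhds (E t - √(C t ^ 2 + D t ^ 2 + 0))) := by
      apply Tendsto.mono_left _ nhdsWithin_le_nhds
      exact Continuous.tendsto (by fun_prop) 0
    rw [add_zero] at hcont
    exact le_of_tendsto hcont (by
      filter_upwards [self_mem_nhdsWithin] with ε hε using hBε ε hε t ht)
  -- choose constants
  set ε := min ((ρ₀ - p t₀) / 2) (L / 2) with hε
  have hεpos : 0 < ε := lt_min (by linarith) (by linarith)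
  have hε1 : ε ≤ (ρ₀ - p t₀) / 2 := min_le_left _ _
  have hε2 : ε ≤ L / 2 := min_le_right _ _
  obtain ⟨c, hcpos, hcg⟩ := hc (p t₀ + ε) (by linarith)
  obtain ⟨T, hT⟩ := ((herr.eventually (gt_mem_nhds (show 0 < ε / 7 by positivity))).and
    (hf.eventually (gt_mem_nhds (show 0 < c * (L / 2) by positivity)))).exists_forall_of_atTop
  set t := max T t₀ with htd
  have htT : T ≤ t := le_max_left _ _
  have htt : t₀ ≤ t := le_max_right _ _
  have ht0 : 0 ≤ t := ht₀.trans htt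
  set R := √(C t ^ 2 + D t ^ 2) with hR
  obtain ⟨s, hs0, hs7, hs⟩ : ∃ s, 0 ≤ s ∧ s ≤ 7 ∧ C t * Real.cos (2 * s) + D t * Real.sin (2 * s) = -R := by
    set z : ℂ := ⟨-C t, -D t⟩ with hz
    have hzn : ‖z‖ = R := by
      rw [Complex.norm_eq_sqrt_sq_add_sq, hR]; simp [hz]
    have hcos : ‖z‖ * Real.cos z.arg = -C t := Complex.norm_mul_cos_arg z
    have hsin : ‖z‖ * Real.sin z.arg = -D t := Complex.norm_mul_sin_arg z
    have h1 := Complex.neg_pi_lt_arg z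
    have h2 := Complex.arg_le_pi z
    have h3 := Real.pi_pos
    have h4 := Real.pi_lt_four
    refine ⟨z.arg / 2 + Real.pi, by linarith, by linarith, ?_⟩
    have h5 : 2 * (z.arg / 2 + Real.pi) = z.arg + 2 * Real.pi := by ring
    rw [h5, Real.cos_add_two_pi, Real.sin_add_two_pi]
    rw [hzn] at hcos hsin
    have := Real.cos_sq_add_sin_sq z.arg
    linear_combination Real.cos z.arg * hcos + Real.sin z.arg * hsin - R * this
  set τ := t + s with hτ
  have hN := cs_anti (f := fun u => C u * Real.cos (2 * (τ - u)) + D u * Real.sin (2 * (τ - u))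
      - ε / 7 * u)
    (f' := fun u => ((2 * D u + f u) * Real.cos (2 * (τ - u)) +
        C u * (-Real.sin (2 * (τ - u)) * (2 * -1))
      + ((q u - g u * D u - p u) * Real.sin (2 * (τ - u)) +
        D u * (Real.cos (2 * (τ - u)) * (2 * -1)))) - ε / 7 * 1) ht0
    (fun u hu => by
      have hu0 := ht0.trans hu
      have h := ((hasDerivWithinAt_id u (Set.Ici 0)).const_sub τ).const_mul 2
      exact (((hC u hu0).mul h.cos).add ((hD u hu0).mul h.sin)).sub
        ((hasDerivWithinAt_id u (Set.Ici 0)).const_mul (ε / 7)))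
    (fun u hu => by
      have hu0 := ht0.trans hu
      have h1 := (hT u (htT.trans hu)).1
      have h2 := hgD u hu0
      have h3 : f u * Real.cos (2 * (τ - u)) ≤ f u :=
        mul_le_of_le_one_right (hf0 u) (Real.cos_le_one _)
      have h4 : |g u * D u * Real.sin (2 * (τ - u))| ≤ |g u * D u| := by
        rw [abs_mul]
        exact mul_le_of_le_one_right (abs_nonneg _) (Real.abs_sin_le_one _)
      have h5 := (abs_le.1 h4).1
      have h6 : q u - p u = -2 * C u := by simp only [hCd]; ring
      have h7 : ((2 * D u + f u) * Real.cos (2 * (τ - u)) +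
        C u * (-Real.sin (2 * (τ - u)) * (2 * -1))
      + ((q u - g u * D u - p u) * Real.sin (2 * (τ - u)) +
        D u * (Real.cos (2 * (τ - u)) * (2 * -1)))) =
        f u * Real.cos (2 * (τ - u)) - g u * D u * Real.sin (2 * (τ - u)) := by
        linear_combination Real.sin (2 * (τ - u)) * h6
      rw [h7]
      linarith) le_rfl (show t ≤ τ by linarith)
  simp only [sub_self, mul_zero, Real.cos_zero, Real.sin_zero, mul_one, add_zero] at hN
  have h8 : τ - t = s := by simp [hτ]
  rw [h8, hs] at hN
  have hτ0 : 0 ≤ τ := by linarith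
  have hCτ : C τ ≤ -R + ε := by
    have : ε / 7 * (τ - t) ≤ ε := by rw [h8]; nlinarith
    linarith
  have hpτ : p τ ≤ p t₀ + ε := by
    have hpE : p τ = E τ + C τ := by simp only [hEd, hCd]; ring
    have := hEanti t τ ht0 (by linarith)
    have := hB t htt
    linarith
  have hqτ : L / 2 ≤ q τ := by
    have hqE : q τ = E τ - C τ := by simp only [hEd, hCd]; ring
    have := hLle τ hτ0
    have : 0 ≤ R := Real.sqrt_nonneg _
    linarith
  have h9 := (hT τ (by linarith)).2
  have h10 : c * (L / 2) ≤ g τ * q τ := mul_le_mul (hcg τ hpτ) hqτ (by linarith) (hg0 τ)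
  simp only [hfd] at h9
  linarith


/-- **Theorem 1.6.** Two-agent Cucker–Smale system with quadratic
confinement `U(x) = |x|²/2` (so `∇U(x) = x`): for almost every initial datum outside
the decoupled-oscillator set `ℋ = {|x₁(t) − x₂(t)| ≥ r₀ ∀ t ≥ 0}`, the solution
aligns and aggregates: `|x₁ − x₂| + |v₁ − v₂| → 0`. -/
theorem stmt15 (n : ℕ)
    (r₀ : ℝ) (hr₀ : 0 < r₀)
    (φ : EuclideanSpace ℝ (Fin n) → ℝ)
    (hφsmooth : ContDiff ℝ (⊤ : ℕ∞) φ) (hφnonneg : ∀ z, 0 ≤ φ z)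
    (hφrad : ∀ z w : EuclideanSpace ℝ (Fin n), ‖z‖ ≤ ‖w‖ → φ w ≤ φ z)
    (hφsupp : ∀ z, 0 < φ z ↔ ‖z‖ < r₀)
    (X V : (Fin 2 → EuclideanSpace ℝ (Fin n)) × (Fin 2 → EuclideanSpace ℝ (Fin n)) →
      ℝ → Fin 2 → EuclideanSpace ℝ (Fin n))
    (hinit : ∀ d, X d 0 = d.1 ∧ V d 0 = d.2)
    (hX : ∀ d i, ∀ t ∈ Set.Ici (0 : ℝ),
      HasDerivWithinAt (fun s => X d s i) (V d t i) (Set.Ici 0) t)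
    (hV : ∀ d i, ∀ t ∈ Set.Ici (0 : ℝ),
      HasDerivWithinAt (fun s => V d s i)
        ((2 : ℝ)⁻¹ • ∑ j, φ (X d t i - X d t j) • (V d t j - V d t i) - X d t i)
        (Set.Ici 0) t) :
    ∀ᵐ d ∂(volume : Measure ((Fin 2 → EuclideanSpace ℝ (Fin n)) ×
        (Fin 2 → EuclideanSpace ℝ (Fin n)))),
      d ∉ {d' | ∀ t ∈ Set.Ici (0 : ℝ), r₀ ≤ ‖X d' t 0 - X d' t 1‖} →
      Tendsto (fun t => ‖X d t 0 - X d t 1‖ + ‖V d t 0 - V d t 1‖) atTop (nhds 0) := by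

  refine Eventually.of_forall fun d hd => ?_
  simp only [Set.mem_ofPred_eq, not_forall, not_le] at hd
  obtain ⟨t₀, ht₀, hlt⟩ := hd
  rw [Set.mem_Ici] at ht₀
  set x : ℝ → EuclideanSpace ℝ (Fin n) := fun t => X d t 0 - X d t 1 with hxd
  set v : ℝ → EuclideanSpace ℝ (Fin n) := fun t => V d t 0 - V d t 1 with hvd
  have hφneg : ∀ z, φ (-z) = φ z := fun z =>
    le_antisymm (hφrad _ _ (by simp)) (hφrad _ _ (by simp))
  have hx : ∀ t, 0 ≤ t → HasDerivWithinAt x (v t) (Set.Ici 0) t := fun t ht =>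
    (hX d 0 t ht).sub (hX d 1 t ht)
  have hv : ∀ t, 0 ≤ t → HasDerivWithinAt v (-(φ (x t) • v t) - x t) (Set.Ici 0) t := by
    intro t ht
    refine ((hV d 0 t ht).sub (hV d 1 t ht)).congr_deriv ?_
    have h1 : φ (X d t 1 - X d t 0) = φ (x t) := by
      rw [← hφneg]; simp [hxd]
    have h2 : φ (X d t 0 - X d t 1) = φ (x t) := rfl
    simp only [Fin.sum_univ_two, h1, h2, sub_self, smul_zero, zero_add, add_zero, hxd, hvd]
    module
  have hp : ∀ t, 0 ≤ t → HasDerivWithinAt (fun t => ‖x t‖ ^ 2) (2 * inner ℝ (x t) (v t))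
      (Set.Ici 0) t := fun t ht => (hx t ht).norm_sq
  have hq : ∀ t, 0 ≤ t → HasDerivWithinAt (fun t => ‖v t‖ ^ 2)
      (-2 * φ (x t) * ‖v t‖ ^ 2 - 2 * inner ℝ (x t) (v t)) (Set.Ici 0) t := fun t ht => by
    refine (hv t ht).norm_sq.congr_deriv ?_
    rw [real_inner_comm (v t) (x t), inner_sub_right, inner_neg_right, inner_smul_right, real_inner_self_eq_norm_sq]
    ring
  have hD : ∀ t, 0 ≤ t → HasDerivWithinAt (fun t => inner ℝ (x t) (v t))
      (‖v t‖ ^ 2 - φ (x t) * inner ℝ (x t) (v t) - ‖x t‖ ^ 2) (Set.Ici 0) t := fun t ht => by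
    refine ((hx t ht).inner ℝ (hv t ht)).congr_deriv ?_
    rw [inner_sub_right, inner_neg_right, inner_smul_right, real_inner_self_eq_norm_sq,
      real_inner_self_eq_norm_sq]
    ring
  have hE : ∀ t, 0 ≤ t → ‖x t‖ ^ 2 + ‖v t‖ ^ 2 ≤ ‖x 0‖ ^ 2 + ‖v 0‖ ^ 2 := fun t ht =>
    cs_anti le_rfl (fun t ht => (hp t ht).add (hq t ht)) (fun t ht => by
      have := mul_nonneg (hφnonneg (x t)) (sq_nonneg ‖v t‖); linarith) le_rfl ht
  set M := √(‖x 0‖ ^ 2 + ‖v 0‖ ^ 2) with hM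
  have hxM : ∀ t, 0 ≤ t → ‖x t‖ ≤ M := fun t ht =>
    Real.le_sqrt_of_sq_le (by have := hE t ht; nlinarith)
  have hvM : ∀ t, 0 ≤ t → ‖v t‖ ≤ M := fun t ht =>
    Real.le_sqrt_of_sq_le (by have := hE t ht; nlinarith)
  have hdiff : Differentiable ℝ φ := hφsmooth.differentiable (by simp)
  have hfc : Continuous (fderiv ℝ φ) := hφsmooth.continuous_fderiv (by simp)
  obtain ⟨A, hA⟩ := (isCompact_closedBall (0 : EuclideanSpace ℝ (Fin n)) M).exists_bound_of_continuousOn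
    hfc.continuousOn
  have hmain : Tendsto (fun t => ‖x t‖ ^ 2 + ‖v t‖ ^ 2) atTop (nhds 0) := by
    refine cs_core (D := fun t => inner ℝ (x t) (v t)) (g := fun t => φ (x t))
      (g' := fun t => fderiv ℝ φ (x t) (v t)) (G := φ 0) (K := A * M) (ρ₀ := r₀ ^ 2) (t₀ := t₀)
      hp hq hD ?_ (fun t => sq_nonneg _) (fun t => sq_nonneg _) ?_ (fun t => hφnonneg _)
      (fun t => hφrad _ _ (by simp)) ?_ ?_ ht₀ ?_
    · intro t ht
      exact (hdiff (x t)).hasFDerivAt.comp_hasDerivWithinAt t (hx t ht)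
    · intro t
      rw [← mul_pow]
      exact sq_le_sq' (by have := abs_le.1 (abs_real_inner_le_norm (x t) (v t)); linarith)
        (real_inner_le_norm _ _)
    · intro t ht
      have h1 := hA (x t) (by simpa using hxM t ht)
      have h2 := (fderiv ℝ φ (x t)).le_opNorm (v t)
      rw [Real.norm_eq_abs] at h2
      exact h2.trans (mul_le_mul h1 (hvM t ht) (norm_nonneg _) ((norm_nonneg _).trans h1))
    · intro ρ hρ
      obtain ⟨z, hz, hzmin⟩ := (isCompact_closedBall (0 : EuclideanSpace ℝ (Fin n)) (√ρ)).exists_isMinOn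
        ⟨0, by simp⟩ hφsmooth.continuous.continuousOn
      refine ⟨φ z, (hφsupp z).2 ?_, fun t ht => hzmin ?_⟩
      · have h1 : ‖z‖ ≤ √ρ := by simpa using hz
        exact h1.trans_lt ((Real.sqrt_lt' hr₀).2 hρ)
      · simpa using Real.le_sqrt_of_sq_le ht
    · exact pow_lt_pow_left₀ hlt (norm_nonneg _) two_ne_zero
  have h2 : Tendsto (fun t => 2 * √(‖x t‖ ^ 2 + ‖v t‖ ^ 2)) atTop (nhds 0) := by
    simpa using hmain.sqrt.const_mul 2
  refine squeeze_zero (fun t => by positivity) (fun t => ?_) h2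
  have a1 : ‖x t‖ ≤ √(‖x t‖ ^ 2 + ‖v t‖ ^ 2) := Real.le_sqrt_of_sq_le (by nlinarith [sq_nonneg ‖v t‖])
  have a2 : ‖v t‖ ≤ √(‖x t‖ ^ 2 + ‖v t‖ ^ 2) := Real.le_sqrt_of_sq_le (by nlinarith [sq_nonneg ‖x t‖])
  simp only [hxd, hvd] at a1 a2 ⊢
  linarith
end

section
/- Let φ : ℝ^n → [0,∞) be a C^1 even kernel and U : ℝ^n → ℝ a C² radial potential with ∇U odd (∇U(−z) = −∇U(z)). Consider the vector field F on V = { (x, v) ∈ (ℝ^n)^N × (ℝ^n)^N : Σ_{i=1}^N x_i = 0, Σ_{i=1}^N v_i = 0 } given by the Cucker–Smale system with pairwise potential interactions, F(x, v) = ( (v_i)_i , ( (1/N) Σ_{j=1}^N φ(x_i − x_j)(v_j − v_i) − (1/N) Σ_{j=1}^N ∇U(x_i − x_j) )_i ). Then F maps V to V, and its divergence as a vector field on the subspace V (the trace of the derivative of F restricted to V) equals −(n/N) Σ_{i≠j} φ(x_i − x_j) at every point (x, v) ∈ V. -/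
open Set MeasureTheory Filter

/-- The null space `V = {(x,v) : Σᵢ xᵢ = 0, Σᵢ vᵢ = 0}` of zero mean position and
momentum, as a subspace of the ensemble space. -/
def nullSpace (n N : ℕ) :
    Submodule ℝ ((Fin N → EuclideanSpace ℝ (Fin n)) × (Fin N → EuclideanSpace ℝ (Fin n))) where
  carrier := {p | (∑ i, p.1 i) = 0 ∧ (∑ i, p.2 i) = 0}
  add_mem' := by
    intro a b ha hb
    refine ⟨?_, ?_⟩ <;>
      simp [Finset.sum_add_distrib, ha.1, ha.2, hb.1, hb.2]
  zero_mem' := by simp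
  smul_mem' := by
    intro c a ha
    refine ⟨?_, ?_⟩ <;>
      simp [← Finset.smul_sum, ha.1, ha.2]

theorem cs_trace_prod {X : Type*} [AddCommGroup X] [Module ℝ X] [Module.Finite ℝ X]
    [Module.Free ℝ X] (M : X × X →ₗ[ℝ] X × X) :
    LinearMap.trace ℝ (X × X) M =
      LinearMap.trace ℝ X (LinearMap.fst ℝ X X ∘ₗ M ∘ₗ LinearMap.inl ℝ X X) +
      LinearMap.trace ℝ X (LinearMap.snd ℝ X X ∘ₗ M ∘ₗ LinearMap.inr ℝ X X) := by
  have h : M = (M ∘ₗ LinearMap.inl ℝ X X) ∘ₗ LinearMap.fst ℝ X X +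
      (M ∘ₗ LinearMap.inr ℝ X X) ∘ₗ LinearMap.snd ℝ X X := by
    apply LinearMap.ext
    rintro ⟨a, b⟩
    simp [← map_add]
  conv_lhs => rw [h]
  rw [map_add, LinearMap.trace_comp_comm', LinearMap.trace_comp_comm' (LinearMap.snd ℝ X X)]

theorem cs_trace_pi {N : ℕ} {Y : Type*} [AddCommGroup Y] [Module ℝ Y] [Module.Finite ℝ Y]
    [Module.Free ℝ Y] (M : (Fin N → Y) →ₗ[ℝ] (Fin N → Y)) :
    LinearMap.trace ℝ (Fin N → Y) M =
      ∑ i, LinearMap.trace ℝ Y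
        (LinearMap.proj i ∘ₗ M ∘ₗ LinearMap.single ℝ (fun _ : Fin N => Y) i) := by
  have h : M = ∑ i, (M ∘ₗ LinearMap.single ℝ (fun _ : Fin N => Y) i) ∘ₗ
      (LinearMap.proj i : (Fin N → Y) →ₗ[ℝ] Y) := by
    apply LinearMap.ext
    intro a
    simp only [LinearMap.sum_apply, LinearMap.comp_apply, ← map_sum]
    congr 1
    exact (Finset.univ_sum_single a).symm
  conv_lhs => rw [h]
  rw [map_sum]
  refine Finset.sum_congr rfl fun i _ => ?_
  rw [LinearMap.trace_comp_comm']

theorem cs_antisymm_sum {N : ℕ} {Y : Type*} [AddCommGroup Y] [Module ℝ Y]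
    (f : Fin N → Fin N → Y) (hf : ∀ i j, f i j = - f j i) : ∑ i, ∑ j, f i j = 0 := by
  have h : ∑ i, ∑ j, f i j = - ∑ i, ∑ j, f i j := by
    conv_lhs => rw [Finset.sum_comm]
    simp only [← Finset.sum_neg_distrib]
    exact Finset.sum_congr rfl fun i _ => Finset.sum_congr rfl fun j _ => hf _ _
  have h2 : (2 : ℝ) • ∑ i, ∑ j, f i j = 0 := by
    rw [two_smul]
    exact eq_neg_iff_add_eq_zero.mp h
  exact (smul_eq_zero.mp h2).resolve_left two_ne_zero

/-- The Cucker–Smale vector field with pairwise potential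
interactions maps the null space `V` (zero mean position and momentum) to itself, and
its divergence as a vector field on `V` — the trace of its derivative restricted to
`V` — equals `−(n/N) Σ_{i≠j} φ(x_i − x_j)`. -/
theorem stmt16 (n N : ℕ) (hN : 2 ≤ N)
    (φ : EuclideanSpace ℝ (Fin n) → ℝ)
    (hφC1 : ContDiff ℝ 1 φ) (hφnonneg : ∀ z, 0 ≤ φ z)
    (hφeven : ∀ z, φ (-z) = φ z)
    (U : EuclideanSpace ℝ (Fin n) → ℝ) (hU : ContDiff ℝ 2 U)
    (hUrad : ∃ u : ℝ → ℝ, ∀ z, U z = u ‖z‖)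
    (hUodd : ∀ z, gradient U (-z) = -gradient U z)
    (F : (Fin N → EuclideanSpace ℝ (Fin n)) × (Fin N → EuclideanSpace ℝ (Fin n)) →
      (Fin N → EuclideanSpace ℝ (Fin n)) × (Fin N → EuclideanSpace ℝ (Fin n)))
    (hF : F = fun p =>
      (p.2, fun i => (N : ℝ)⁻¹ • ∑ j, φ (p.1 i - p.1 j) • (p.2 j - p.2 i)
        - (N : ℝ)⁻¹ • ∑ j, gradient U (p.1 i - p.1 j))) :
    (∀ p ∈ nullSpace n N, F p ∈ nullSpace n N) ∧
    ∀ p ∈ nullSpace n N,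
      ∃ h : ∀ w ∈ nullSpace n N, (fderiv ℝ F p).toLinearMap w ∈ nullSpace n N,
        LinearMap.trace ℝ (nullSpace n N) ((fderiv ℝ F p).toLinearMap.restrict h) =
          -((n : ℝ) / (N : ℝ)) * ∑ i, ∑ j ∈ Finset.univ.erase i, φ (p.1 i - p.1 j) := by
  have hN0 : (N : ℝ) ≠ 0 := by positivity
  have hsum : ∀ p, ∑ i, (F p).2 i = 0 := by
    intro p
    subst hF
    simp only [Finset.sum_sub_distrib, ← Finset.smul_sum]
    rw [cs_antisymm_sum (fun i j => φ (p.1 i - p.1 j) • (p.2 j - p.2 i)),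
      cs_antisymm_sum (fun i j => gradient U (p.1 i - p.1 j))]
    · simp
    · intro i j
      rw [← hUodd, neg_sub]
    · intro i j
      rw [← hφeven, neg_sub, ← smul_neg, neg_sub]
  have hfst : ∀ p, (F p).1 = p.2 := by intro p; rw [hF]
  refine ⟨fun p hp => ⟨by rw [hfst]; exact hp.2, hsum p⟩, fun p hp => ?_⟩
  have hgrad : Differentiable ℝ (gradient U) := by
    have h1 : Differentiable ℝ (fderiv ℝ U) :=
      (hU.fderiv_right (m := 1) (by norm_num)).differentiable (by norm_num)
    exact ((InnerProductSpace.toDual ℝ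
      (EuclideanSpace ℝ (Fin n))).symm.toContinuousLinearEquiv.differentiable).comp h1
  have hφd : Differentiable ℝ φ := hφC1.differentiable (by norm_num)
  have hFd : Differentiable ℝ F := by
    rw [hF]
    fun_prop
  have hL := (hFd p).hasFDerivAt
  set L := fderiv ℝ F p with hLdef
  have hL1 : ∀ w, (L w).1 = w.2 := by
    intro w
    have h1 := hL.fst
    have h2 : HasFDerivAt (fun q => (F q).1) (ContinuousLinearMap.snd ℝ
        (Fin N → EuclideanSpace ℝ (Fin n)) (Fin N → EuclideanSpace ℝ (Fin n))) p := by
      simp only [hfst]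
      exact hasFDerivAt_snd
    exact DFunLike.congr_fun (h1.unique h2) w
  have hLs : ∀ w, ∑ i, (L w).2 i = 0 := by
    intro w
    have h1 : HasFDerivAt (fun q => ∑ i, (F q).2 i) (∑ i, (ContinuousLinearMap.proj i).comp
        ((ContinuousLinearMap.snd ℝ (Fin N → EuclideanSpace ℝ (Fin n))
          (Fin N → EuclideanSpace ℝ (Fin n))).comp L)) p :=
      HasFDerivAt.fun_sum fun i _ => (hasFDerivAt_pi'.mp hL.snd) i
    simp only [hsum] at h1
    have := DFunLike.congr_fun (h1.unique (hasFDerivAt_const _ _)) w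
    simpa using this
  have hLb : ∀ b i, (L (0, b)).2 i = (N : ℝ)⁻¹ • ∑ j, φ (p.1 i - p.1 j) • (b j - b i) := by
    intro b i
    have h0 : HasDerivAt (fun t : ℝ => p + t • ((0, b) :
        (Fin N → EuclideanSpace ℝ (Fin n)) × (Fin N → EuclideanSpace ℝ (Fin n)))) (0, b) 0 := by
      simpa using ((hasDerivAt_id (0 : ℝ)).smul_const (0, b)).const_add p
    have h1 : HasDerivAt (fun t : ℝ => F (p + t • (0, b))) (L (0, b)) 0 := by
      apply HasFDerivAt.comp_hasDerivAt (0 : ℝ) _ h0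
      simpa using hL
    have h2 := (hasDerivAt_pi.mp h1.snd) i
    have h3 : ∀ t : ℝ, (F (p + t • (0, b))).2 i = (F p).2 i +
        t • ((N : ℝ)⁻¹ • ∑ j, φ (p.1 i - p.1 j) • (b j - b i)) := by
      intro t
      rw [hF]
      have : ∀ j, (p.2 j + t • b j - (p.2 i + t • b i)) =
          (p.2 j - p.2 i) + t • (b j - b i) := by
        intro j; module
      simp only [Prod.snd_add, Prod.fst_add, Prod.smul_mk, smul_zero, add_zero, Pi.add_apply, Pi.zero_apply,
        Pi.smul_apply, this, smul_add, Finset.sum_add_distrib]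
      have h4 : ∑ j, φ (p.1 i - p.1 j) • t • (b j - b i) =
          t • ∑ j, φ (p.1 i - p.1 j) • (b j - b i) := by
        rw [Finset.smul_sum]
        exact Finset.sum_congr rfl fun j _ => smul_comm _ _ _
      rw [h4]
      module
    simp only [h3] at h2
    have h5 : HasDerivAt (fun t : ℝ => (F p).2 i +
        t • ((N : ℝ)⁻¹ • ∑ j, φ (p.1 i - p.1 j) • (b j - b i)))
        ((N : ℝ)⁻¹ • ∑ j, φ (p.1 i - p.1 j) • (b j - b i)) 0 := by
      simpa using ((hasDerivAt_id (0 : ℝ)).smul_const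
        ((N : ℝ)⁻¹ • ∑ j, φ (p.1 i - p.1 j) • (b j - b i))).const_add ((F p).2 i)
    exact h2.unique h5
  have hmem : ∀ w ∈ nullSpace n N, L.toLinearMap w ∈ nullSpace n N := by
    intro w hw
    refine ⟨?_, hLs w⟩
    have := hL1 w
    change ∑ i, (L w).1 i = 0
    rw [this]
    exact hw.2
  refine ⟨hmem, ?_⟩
  let m : (Fin N → EuclideanSpace ℝ (Fin n)) →ₗ[ℝ] (Fin N → EuclideanSpace ℝ (Fin n)) :=
    LinearMap.id - LinearMap.pi fun _ => (N : ℝ)⁻¹ • ∑ j, LinearMap.proj j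
  have hm : ∀ a i, m a i = a i - (N : ℝ)⁻¹ • ∑ j, a j := by
    intro a i
    simp [m]
  have hm0 : ∀ a, ∑ i, m a i = 0 := by
    intro a
    simp only [hm, Finset.sum_sub_distrib, Finset.sum_const, Finset.card_univ, Fintype.card_fin]
    rw [← Nat.cast_smul_eq_nsmul ℝ, smul_smul, mul_inv_cancel₀ hN0, one_smul, sub_self]
  have hmV : ∀ a, ∑ i, a i = 0 → m a = a := by
    intro a ha
    ext1 i
    rw [hm, ha, smul_zero, sub_zero]
  let P : ((Fin N → EuclideanSpace ℝ (Fin n)) × (Fin N → EuclideanSpace ℝ (Fin n))) →ₗ[ℝ]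
      nullSpace n N := (m.prodMap m).codRestrict (nullSpace n N) fun w => ⟨hm0 w.1, hm0 w.2⟩
  have hP : ∀ w, ((P w : nullSpace n N) : (Fin N → EuclideanSpace ℝ (Fin n)) ×
      (Fin N → EuclideanSpace ℝ (Fin n))) = (m w.1, m w.2) := fun w => rfl
  have hres : L.toLinearMap.restrict hmem =
      P ∘ₗ (L.toLinearMap ∘ₗ (nullSpace n N).subtype) := by
    apply LinearMap.ext
    intro w
    apply Subtype.ext
    have hw := hmem w w.2
    change L.toLinearMap w = (m (L.toLinearMap w).1, m (L.toLinearMap w).2)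
    rw [hmV _ hw.1, hmV _ hw.2]
  rw [hres, LinearMap.trace_comp_comm', cs_trace_prod]
  have hA : (LinearMap.fst ℝ _ _ ∘ₗ ((L.toLinearMap ∘ₗ (nullSpace n N).subtype) ∘ₗ P) ∘ₗ
      LinearMap.inl ℝ (Fin N → EuclideanSpace ℝ (Fin n)) (Fin N → EuclideanSpace ℝ (Fin n))) =
      0 := by
    apply LinearMap.ext
    intro a
    change (L (m a, m 0)).1 = 0
    rw [hL1, map_zero]
  rw [hA, map_zero, zero_add, cs_trace_pi]
  have hB : ∀ i, (LinearMap.proj i ∘ₗ (LinearMap.snd ℝ _ _ ∘ₗ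
      ((L.toLinearMap ∘ₗ (nullSpace n N).subtype) ∘ₗ P) ∘ₗ
      LinearMap.inr ℝ (Fin N → EuclideanSpace ℝ (Fin n)) (Fin N → EuclideanSpace ℝ (Fin n))) ∘ₗ
      LinearMap.single ℝ (fun _ : Fin N => EuclideanSpace ℝ (Fin n)) i) =
      (-(N : ℝ)⁻¹ * ∑ j ∈ Finset.univ.erase i, φ (p.1 i - p.1 j)) • LinearMap.id := by
    intro i
    apply LinearMap.ext
    intro y
    rw [LinearMap.smul_apply, LinearMap.id_apply]
    change (L (m 0, m (Pi.single i y))).2 i = _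
    rw [map_zero, hLb]
    simp only [hm, sub_sub_sub_cancel_right]
    rw [← Finset.add_sum_erase _ _ (Finset.mem_univ i), sub_self, sub_self, smul_zero,
      zero_add]
    rw [neg_mul, ← mul_neg, mul_smul, ← Finset.sum_neg_distrib, Finset.sum_smul]
    congr 1
    refine Finset.sum_congr rfl fun j hj => ?_
    rw [Pi.single_eq_same, Pi.single_eq_of_ne (Finset.ne_of_mem_erase hj), zero_sub, smul_neg,
      neg_smul]
  simp only [hB, map_smul, LinearMap.trace_id, finrank_euclideanSpace, Fintype.card_fin]
  rw [Finset.mul_sum]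
  refine Finset.sum_congr rfl fun i _ => ?_
  rw [smul_eq_mul]
  ring
end
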